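/- arXiv:2512.07238 — 2 statements merged into one kernel-verified Lean document; each statement's English description precedes it below -/
import Mathlib

section
/- Let N and Q be groups with N finitely generated and residually finite and Q residually finite, and let G = N ⋊ Q be any (internal or external) semidirect product of N by Q. Then G is residually finite. -/
def ResiduallyFinite (G : Type*) [Group G] : Prop :=
  ∀ g : G, g ≠ 1 → ∃ (Q : Type) (_ : Group Q) (_ : Finite Q) (ρ : G →* Q), ρ g ≠ 1

theorem finite_monoidHom_of_fg (N F : Type*) [Group N] [Group.FG N] [Group F] [Finite F] :
    Finite (N →* F) := by
  obtain ⟨S, hS⟩ := Group.fg_def.mp ‹Group.FG N›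
  refine Finite.of_injective (fun (ψ : N →* F) (s : S) ↦ ψ s) fun ψ₁ ψ₂ h ↦ ?_
  exact MonoidHom.eq_of_eqOn_dense hS fun s hs ↦ congrFun h ⟨s, hs⟩

/-- Given an action `φ` of `Q` on `N`, the semidirect product acts on `(N →* F) × F`: here `N` acts
on the fibre over `ψ` through `ψ`, and `Q` permutes the fibres by precomposition. -/
def SemidirectProduct.homProdEnd {N Q : Type*} [Group N] [Group Q] (φ : Q →* MulAut N)
    (F : Type*) [Group F] : N ⋊[φ] Q →* Function.End ((N →* F) × F) where
  toFun g := fun p ↦ (p.1.comp (φ g.right⁻¹).toMonoidHom, p.1 (φ g.right⁻¹ g.left) * p.2)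
  map_one' := by
    funext p
    refine Prod.ext (MonoidHom.ext fun x ↦ ?_) ?_ <;> simp [Function.End.one_def]
  map_mul' g h := by
    funext p
    refine Prod.ext (MonoidHom.ext fun x ↦ ?_) ?_ <;>
      simp [mul_assoc] <;> rfl

theorem SemidirectProduct.homProdEnd_apply {N Q : Type*} [Group N] [Group Q] (φ : Q →* MulAut N)
    (F : Type*) [Group F] (g : N ⋊[φ] Q) (p : (N →* F) × F) :
    homProdEnd φ F g p = (p.1.comp (φ g.right⁻¹).toMonoidHom, p.1 (φ g.right⁻¹ g.left) * p.2) :=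
  rfl

theorem exists_finite_type_monoidHom_ne_one {G Y : Type*} [Group G] [Finite Y]
    (ρ : G →* Equiv.Perm Y) {g : G} (hg : ρ g ≠ 1) :
    ∃ (Q : Type) (_ : Group Q) (_ : Finite Q) (σ : G →* Q), σ g ≠ 1 := by
  obtain ⟨n, ⟨e⟩⟩ := Finite.exists_equiv_fin Y
  exact ⟨Equiv.Perm (Fin n), inferInstance, inferInstance,
    e.permCongrHom.toMonoidHom.comp ρ, fun h ↦ hg (e.permCongrHom.map_eq_one_iff.mp h)⟩

/-- A semidirect product of a finitely generated residually finite group by a residually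
finite group is residually finite. -/
theorem residuallyFinite_semidirectProduct {N Q : Type*} [Group N] [Group Q] [Group.FG N]
    (hN : ResiduallyFinite N) (hQ : ResiduallyFinite Q) (φ : Q →* MulAut N) :
    ResiduallyFinite (N ⋊[φ] Q) := by
  intro g hg
  by_cases hq : g.right = 1
  · have hn : g.left ≠ 1 := fun hn ↦ hg (SemidirectProduct.ext hn hq)
    obtain ⟨F, _, _, ψ, hψ⟩ := hN g.left hn
    have := finite_monoidHom_of_fg N F
    refine exists_finite_type_monoidHom_ne_one
      (SemidirectProduct.homProdEnd φ F).toHomPerm fun h ↦ hψ ?_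
    have h' : (SemidirectProduct.homProdEnd φ F g (ψ, 1)).2 = 1 :=
      congrArg Prod.snd (Equiv.congr_fun h (ψ, 1))
    simpa [SemidirectProduct.homProdEnd_apply, hq] using h'
  · obtain ⟨F, _, _, ψ, hψ⟩ := hQ g.right hq
    exact ⟨F, inferInstance, inferInstance, ψ.comp SemidirectProduct.rightHom, hψ⟩
end

section
/- Let G be a group and N a normal subgroup of G such that N is a finitely generated non-abelian free group, and suppose the quotient group G/N is residually finite. Then G is residually finite. -/
/-- Every nontrivial element of a free group survives in a finite quotient: `g` is a product of
letters, and a finite set `S` containing all the corresponding partial products carries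
permutations extending the partially defined left multiplications by generators. -/
theorem FreeGroup.exists_finite_map_ne_one {α : Type*} (g : FreeGroup α) (hg : g ≠ 1) :
    ∃ (n : ℕ) (ρ : FreeGroup α →* Equiv.Perm (Fin n)), ρ g ≠ 1 := by
  classical
  obtain ⟨w, rfl⟩ : ∃ w, FreeGroup.mk w = g := Quot.exists_rep g
  let S : Finset (FreeGroup α) := (w.tails.map FreeGroup.mk).toFinset
  have mem_S {l : List (α × Bool)} (hl : l <:+ w) : FreeGroup.mk l ∈ S := by
    simp only [S, List.mem_toFinset, List.mem_map, List.mem_tails]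
    exact ⟨l, hl, rfl⟩
  let e (a : α) : {x : S // FreeGroup.of a * x.1 ∈ S} ≃
      {y : S // (FreeGroup.of a)⁻¹ * y.1 ∈ S} :=
    { toFun x := ⟨⟨_, x.2⟩, by simp⟩
      invFun y := ⟨⟨_, y.2⟩, by simp⟩
      left_inv x := by simp
      right_inv y := by simp }
  let σ (a : α) : Equiv.Perm S := (e a).extendSubtype
  have σ_apply (a : α) (x y : S) (h : FreeGroup.of a * x.1 = y.1) : σ a x = y := by
    have hx : FreeGroup.of a * x.1 ∈ S := h ▸ y.2
    rw [show σ a x = _ from (e a).extendSubtype_apply_of_mem x hx]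
    exact Subtype.ext h
  have lift_apply (l : List (α × Bool)) (hl : l <:+ w) :
      FreeGroup.lift σ (FreeGroup.mk l) ⟨1, mem_S w.nil_suffix⟩ = ⟨_, mem_S hl⟩ := by
    induction l with
    | nil => rfl
    | cons s l ih =>
      have hl' : l <:+ w := (List.suffix_cons s l).trans hl
      have hmul : FreeGroup.mk (s :: l) = FreeGroup.mk [s] * FreeGroup.mk l := by simp
      have key : FreeGroup.lift σ (FreeGroup.mk [s]) ⟨_, mem_S hl'⟩ = ⟨_, mem_S hl⟩ := by
        obtain ⟨a, _ | _⟩ := s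
        · have hinv : FreeGroup.mk [(a, false)] = (FreeGroup.of a)⁻¹ := rfl
          rw [hinv, _root_.map_inv, FreeGroup.lift_apply_of, Equiv.Perm.inv_eq_iff_eq]
          refine (σ_apply _ _ _ ?_).symm
          simp [hmul, hinv]
        · change FreeGroup.lift σ (FreeGroup.of a) _ = _
          rw [FreeGroup.lift_apply_of]
          exact σ_apply _ _ _ hmul.symm
      rw [← key, ← ih hl', ← Equiv.Perm.mul_apply, ← _root_.map_mul, ← hmul]
  refine ⟨_, (Finite.equivFin S).permCongrHom.toMonoidHom.comp (FreeGroup.lift σ), fun h ↦ hg ?_⟩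
  have h1 : FreeGroup.lift σ (FreeGroup.mk w) = 1 :=
    (map_eq_one_iff _ (Finite.equivFin S).permCongrHom.injective).1 h
  have h2 := lift_apply w List.suffix_rfl
  rw [h1] at h2
  exact (Subtype.ext_iff.1 h2).symm

/-- The center of a free group on at least two generators is trivial. -/
theorem FreeGroup.eq_one_of_forall_commute {α : Type*} [Nontrivial α] (c : FreeGroup α)
    (hc : ∀ x, Commute c x) : c = 1 := by
  classical
  rw [← FreeGroup.toWord_eq_nil_iff]
  rcases hw : c.toWord with _ | ⟨s, l⟩
  · rfl
  obtain ⟨b, hb⟩ := exists_ne s.1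
  have h1 : (FreeGroup.of b * c).toWord = (b, true) :: s :: l := by
    have hred := c.reduce_toWord
    rw [hw] at hred
    rw [FreeGroup.toWord_mul, hw, FreeGroup.toWord_of, List.singleton_append,
      FreeGroup.reduce.cons, hred]
    simp [hb]
  have h2 := FreeGroup.toWord_mul_sublist c (FreeGroup.of b)
  rw [(hc _).eq, h1, hw, FreeGroup.toWord_of] at h2
  have h3 := h2.eq_of_length (by simp)
  simp only [List.cons_append, List.cons.injEq] at h3
  exact absurd (congrArg Prod.fst h3.1) hb

/-- A non-commutative free group has trivial center. -/
theorem IsFreeGroup.eq_one_of_forall_commute {N : Type*} [Group N] [IsFreeGroup N]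
    (hN : ¬ ∀ a b : N, a * b = b * a) (c : N) (hc : ∀ x, Commute c x) : c = 1 := by
  let e := IsFreeGroup.toFreeGroup N
  have : Nontrivial (IsFreeGroup.Generators N) := by
    by_contra h
    rw [not_nontrivial_iff_subsingleton] at h
    refine hN fun a b ↦ e.injective ?_
    rw [map_mul, map_mul]
    rcases isEmpty_or_nonempty (IsFreeGroup.Generators N) with _ | ⟨⟨x⟩⟩
    · exact Subsingleton.elim _ _
    · have : Unique (IsFreeGroup.Generators N) := uniqueOfSubsingleton x
      exact FreeGroup.mulEquivIntOfUnique.injective (by simp only [map_mul, mul_comm])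
  refine (map_eq_one_iff e e.injective).1 (FreeGroup.eq_one_of_forall_commute _ fun x ↦ ?_)
  simpa using (hc (e.symm x)).map e

/-- There are finitely many homomorphisms from a finitely generated group to a finite group. -/
theorem MonoidHom.finite_of_fg (N Q : Type*) [Group N] [Group.FG N] [Group Q] [Finite Q] :
    Finite (N →* Q) := by
  obtain ⟨S, hS⟩ := Group.fg_def.1 ‹Group.FG N›
  refine .of_injective (fun (f : N →* Q) (x : S) ↦ f x) fun f g h ↦ ?_
  exact MonoidHom.eq_of_eqOn_dense hS fun x hx ↦ congrFun h ⟨x, hx⟩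

/-- Automorphisms of `N` act on the homomorphisms out of `N` by precomposition with the inverse. -/
def MulAut.permMonoidHom (N Q : Type*) [Group N] [Group Q] : MulAut N →* Equiv.Perm (N →* Q) :=
  MonoidHom.toHomPerm
    { toFun φ f := f.comp (φ⁻¹).toMonoidHom
      map_one' := rfl
      map_mul' φ ψ := by
        funext f
        change _ = (f.comp (ψ⁻¹).toMonoidHom).comp (φ⁻¹).toMonoidHom
        ext x
        simp }

/-- A group with a finitely generated non-abelian free normal subgroup whose quotient is
residually finite is residually finite. -/
theorem residuallyFinite_of_nonabelian_free_normal {G : Type*} [Group G]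
    (N : Subgroup G) [N.Normal] [Group.FG N] [IsFreeGroup N]
    (hNab : ¬ ∀ a b : N, a * b = b * a)
    (hQ : ResiduallyFinite (G ⧸ N)) :
    ResiduallyFinite G := by
  intro g hg
  by_cases hgN : g ∈ N
  · obtain ⟨h, hgh⟩ : ∃ h : N, ¬ Commute ⟨g, hgN⟩ h := by
      by_contra! hcomm
      exact hg (congrArg Subtype.val (IsFreeGroup.eq_one_of_forall_commute hNab _ hcomm))
    have hconj : h * (MulAut.conjNormal g⁻¹ h)⁻¹ ≠ 1 := by
      rw [mul_inv_eq_one.ne]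
      refine fun heq ↦ hgh (Subtype.ext ?_)
      have heq' := congrArg Subtype.val heq
      rw [MulAut.conjNormal_apply] at heq'
      change g * h = h * g
      nth_rewrite 1 [heq']
      group
    let e := IsFreeGroup.toFreeGroup N
    obtain ⟨n, ρ, hρ⟩ := FreeGroup.exists_finite_map_ne_one _
      ((map_eq_one_iff e e.injective).not.2 hconj)
    have := MonoidHom.finite_of_fg N (Equiv.Perm (Fin n))
    let E := (Finite.equivFin (N →* Equiv.Perm (Fin n))).permCongrHom
    refine ⟨_, inferInstance, inferInstance, E.toMonoidHom.comp
      ((MulAut.permMonoidHom N (Equiv.Perm (Fin n))).comp MulAut.conjNormal), fun h1 ↦ hρ ?_⟩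
    have h2 : MulAut.permMonoidHom N (Equiv.Perm (Fin n)) (MulAut.conjNormal g) = 1 :=
      (map_eq_one_iff _ E.injective).1 h1
    have h3 : (ρ.comp e.toMonoidHom) ((MulAut.conjNormal g)⁻¹ h) = (ρ.comp e.toMonoidHom) h :=
      DFunLike.congr_fun (DFunLike.congr_fun h2 (ρ.comp e.toMonoidHom)) h
    rw [← map_inv] at h3
    change (ρ.comp e.toMonoidHom) _ = 1
    rw [map_mul, map_inv, h3, mul_inv_cancel]
  · obtain ⟨Q, _, _, ρ, hρ⟩ := hQ g (by simpa using hgN)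
    exact ⟨Q, _, ‹_›, ρ.comp (QuotientGroup.mk' N), hρ⟩
end
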